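/- arXiv:1812.11796 — 2 statements merged into one kernel-verified Lean document; each statement's English description precedes it below -/
import Mathlib

section
/- For the single-sequence SDP with parameter n ≥ 3, a positive semidefinite n×n matrix Y is feasible for the dual (D) (i.e. trace(AᵢY) = cᵢ for all i = 1,…,n−1) if and only if all entries of Y in its first n−2 rows and columns are zero and Y_{n−1,n−1} = 1. -/
open Matrix

/-- `Eij n i j` : the `n×n` symmetric matrix whose only nonzero entries are `1`
in positions `(i,j)` and `(j,i)` (0-based indices). -/
def Eij (n i j : ℕ) : Matrix (Fin n) (Fin n) ℝ :=
  Matrix.of fun a b => if (a.val = i ∧ b.val = j) ∨ (a.val = j ∧ b.val = i) then 1 else 0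

/-- The constraint matrices of the single-sequence SDP (0-based index `k`):
`A₁ = E₁` and `Aᵢ = Eᵢ + E_{i-1,n}` for `i = 2, …, n-1` (1-based indices of the paper). -/
def singleA (n : ℕ) : Fin (n - 1) → Matrix (Fin n) (Fin n) ℝ := fun k =>
  if k.val = 0 then Eij n 0 0 else Eij n k.val k.val + Eij n (k.val - 1) (n - 1)

/-- The objective vector of the single-sequence SDP: `c = e_{n-1} ∈ ℝ^{n-1}`. -/
def singleC (n : ℕ) : Fin (n - 1) → ℝ := fun k => if k.val = n - 2 then 1 else 0

/-- A vanishing diagonal entry of a positive semidefinite matrix forces its column to vanish. -/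
theorem Matrix.PosSemidef.apply_eq_zero_of_diag_eq_zero {ι : Type*} [Fintype ι] [DecidableEq ι]
    {Y : Matrix ι ι ℝ} (hY : Y.PosSemidef) {i : ι} (h : Y i i = 0) (j : ι) : Y j i = 0 := by
  have h0 : Y *ᵥ Pi.single i 1 = 0 := by
    rw [← hY.dotProduct_mulVec_zero_iff]
    simp [h]
  simpa using congrFun h0 j

theorem Eij_self {n : ℕ} (i : Fin n) : Eij n i i = Matrix.single i i 1 := by
  ext a b
  simp only [Eij, Matrix.of_apply, Matrix.single_apply, ← Fin.ext_iff, or_self, eq_comm]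

theorem Eij_of_ne {n : ℕ} {i j : Fin n} (hij : i ≠ j) :
    Eij n i j = Matrix.single i j 1 + Matrix.single j i 1 := by
  ext a b
  simp only [Eij, Matrix.of_apply, Matrix.add_apply, Matrix.single_apply, ← Fin.ext_iff]
  grind

theorem trace_Eij_self_mul {n : ℕ} (i : Fin n) (Y : Matrix (Fin n) (Fin n) ℝ) :
    (Eij n i i * Y).trace = Y i i := by
  simp [Eij_self, Matrix.trace_single_mul]

theorem trace_Eij_mul_of_ne {n : ℕ} {i j : Fin n} (hij : i ≠ j)
    (Y : Matrix (Fin n) (Fin n) ℝ) : (Eij n i j * Y).trace = Y j i + Y i j := by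
  simp [Eij_of_ne hij, Matrix.add_mul, Matrix.trace_single_mul]

theorem trace_singleA_zero_mul {n : ℕ} (hn : 0 < n - 1) (Y : Matrix (Fin n) (Fin n) ℝ) :
    (singleA n ⟨0, hn⟩ * Y).trace = Y ⟨0, by omega⟩ ⟨0, by omega⟩ := by
  simpa [singleA] using trace_Eij_self_mul ⟨0, by omega⟩ Y

theorem trace_singleA_succ_mul {n k : ℕ} (hk : k + 1 < n - 1) (Y : Matrix (Fin n) (Fin n) ℝ) :
    (singleA n ⟨k + 1, hk⟩ * Y).trace =
      Y ⟨k + 1, by omega⟩ ⟨k + 1, by omega⟩ +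
        (Y ⟨n - 1, by omega⟩ ⟨k, by omega⟩ + Y ⟨k, by omega⟩ ⟨n - 1, by omega⟩) := by
  have h₁ := trace_Eij_self_mul (⟨k + 1, by omega⟩ : Fin n) Y
  have h₂ := trace_Eij_mul_of_ne (i := (⟨k, by omega⟩ : Fin n)) (j := ⟨n - 1, by omega⟩)
    (by simp only [ne_eq, Fin.mk.injEq]; omega) Y
  simp only [singleA, Nat.add_eq_zero_iff, one_ne_zero, and_false, if_false,
    Nat.add_sub_cancel, Matrix.add_mul, Matrix.trace_add]
  rw [← h₁, ← h₂]

/-- For the single-sequence SDP with parameter `n ≥ 3`, a psd matrix `Y` is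
feasible for the dual (D) iff all entries of `Y` in its first `n-2` rows and
columns are zero and `Y_{n-1,n-1} = 1` (1-based; entry `(n-2, n-2)` 0-based). -/
theorem singleSeq_dual_feasible {n : ℕ} (hn : 3 ≤ n)
    (Y : Matrix (Fin n) (Fin n) ℝ) (hY : Y.PosSemidef) :
    (∀ k : Fin (n - 1), ((singleA n k) * Y).trace = singleC n k) ↔
    ((∀ a b : Fin n, a.val < n - 2 → Y a b = 0 ∧ Y b a = 0) ∧
      Y ⟨n - 2, by omega⟩ ⟨n - 2, by omega⟩ = 1) := by
  obtain ⟨m, rfl⟩ : ∃ m, n = m + 3 := ⟨n - 3, by omega⟩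
  have hsymm (a b : Fin (m + 3)) : Y a b = Y b a := by simpa using hY.isHermitian.apply b a
  constructor
  · intro h
    have hdiag (k : ℕ) (hk : k < m + 1) : Y ⟨k, by omega⟩ ⟨k, by omega⟩ = 0 := by
      induction k with
      | zero =>
        have ht := trace_singleA_zero_mul (n := m + 3) (by omega) Y
        rw [h, singleC, if_neg (by simp only; omega)] at ht
        exact ht.symm
      | succ k ih =>
        have hcol := hY.apply_eq_zero_of_diag_eq_zero (ih (by omega)) ⟨m + 2, by omega⟩
        have ht := trace_singleA_succ_mul (n := m + 3) (k := k) (by omega) Y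
        rw [h, singleC, if_neg (by simp only; omega)] at ht
        have hrow := hsymm ⟨k, by omega⟩ ⟨m + 2, by omega⟩
        simp only [Nat.add_succ_sub_one] at ht
        linarith
    have hcols (a b : Fin (m + 3)) (ha : a.val < m + 1) : Y b a = 0 :=
      hY.apply_eq_zero_of_diag_eq_zero (hdiag a ha) b
    refine ⟨fun a b ha => ⟨(hsymm a b).trans (hcols a b ha), hcols a b ha⟩, ?_⟩
    have ht := trace_singleA_succ_mul (n := m + 3) (k := m) (by omega) Y
    rw [h, singleC, if_pos (by simp only; omega), hcols ⟨m, by omega⟩ _ (by simp),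
      hsymm ⟨m, by omega⟩, hcols ⟨m, by omega⟩ _ (by simp)] at ht
    simpa using ht.symm
  · rintro ⟨hzero, hone⟩ ⟨k, hk⟩
    cases k with
    | zero =>
      rw [trace_singleA_zero_mul, (hzero _ _ (by simp)).1, singleC, if_neg]
      simp
    | succ k =>
      rw [trace_singleA_succ_mul, (hzero ⟨k, by omega⟩ _ (by simp only; omega)).1,
        (hzero ⟨k, by omega⟩ _ (by simp only; omega)).2, singleC]
      simp only [add_zero]
      split_ifs with hlast
      · simpa only [hlast] using hone
      · exact (hzero _ _ (by simp only; omega)).1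
end

section
/- (Concretized first half of the theorem that maximal singularity degree of the homogeneous dual implies zero duality gap.) Let (B, A₁,…,A_m) be a regularized facial reduction sequence for the n×n psd cone with block sizes r₀, r₁,…,r_m, so in particular B = I_{r₀} ⊕ 0. Define the index sets I₀ = {1,…,r₀}, I_k = {r₀+…+r_{k−1}+1, …, r₀+…+r_k} for k = 1,…,m, and I_{m+1} = {r₀+…+r_m+1, …, n}. Assume that for every i = 1,…,m the submatrix of A_i with rows in I_{i−1} and columns in I_{i+1} ∪ … ∪ I_{m+1} is nonzero. Then the only x ∈ ℝ^m for which B − ∑ᵢ xᵢAᵢ is positive semidefinite is x = 0. -/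
open Matrix

/-- `partialSum r k = r 0 + r 1 + ⋯ + r (k-1)`. -/
def partialSum (r : ℕ → ℕ) (k : ℕ) : ℕ := ∑ j ∈ Finset.range k, r j

/-- A matrix `M` is a step of a regularized facial reduction sequence with prior
rows `lo` and identity block ending at row `hi`: `M` is symmetric, its entries in
rows and columns indexed `≥ lo` form an identity block in positions
`lo ≤ a = b < hi` and are zero otherwise (entries in the first `lo` rows and
columns are arbitrary). -/
def IsRegFRStep (n : ℕ) (M : Matrix (Fin n) (Fin n) ℝ) (lo hi : ℕ) : Prop :=
  M.IsSymm ∧ ∀ a b : Fin n, lo ≤ a.val → lo ≤ b.val →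
    M a b = if a = b ∧ a.val < hi then 1 else 0

theorem Matrix.PosSemidef.apply_eq_zero_of_diag_eq_zero_s16 {ι : Type*}
    {M : Matrix ι ι ℝ} (hM : M.PosSemidef) (a : ι) {b : ι}
    (hb : M b b = 0) : M a b = 0 := by
  have hdet := (hM.submatrix ![a, b]).det_nonneg
  have hsymm : M b a = M a b := by simpa using hM.isHermitian.apply a b
  simp only [det_fin_two, submatrix_apply, cons_val_zero, cons_val_one, hb, hsymm] at hdet
  nlinarith [sq_nonneg (M a b)]

theorem partialSum_mono (r : ℕ → ℕ) : Monotone (partialSum r) := fun _ _ h =>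
  Finset.sum_le_sum_of_subset (Finset.range_mono h)

/-- Past the identity block, the trailing part of a facial reduction step vanishes. -/
theorem IsRegFRStep.apply_eq_zero {n : ℕ} {M : Matrix (Fin n) (Fin n) ℝ} {lo hi : ℕ}
    (hM : IsRegFRStep n M lo hi) {a b : Fin n} (ha : lo ≤ a.val) (hb : lo ≤ b.val)
    (hb' : hi ≤ b.val) : M a b = 0 := by
  rw [hM.2 a b ha hb, if_neg]
  rintro ⟨rfl, h⟩
  omega

/-- (Concretized first half of: maximal singularity degree of the homogeneous dual
implies zero duality gap.) If `(B, A₁,…,A_m)` is a regularized facial reduction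
sequence with block sizes `r₀, r₁,…,r_m`, and for every `i` the submatrix of `Aᵢ`
with rows in `I_{i-1}` and columns in `I_{i+1} ∪ ⋯ ∪ I_{m+1}` is nonzero, then the
only `x ∈ ℝ^m` with `B - ∑ᵢ xᵢAᵢ` positive semidefinite is `x = 0`. -/
theorem regFR_unique_feasible {n m : ℕ} (r : ℕ → ℕ)
    (hsum : partialSum r (m + 1) ≤ n)
    (B : Matrix (Fin n) (Fin n) ℝ) (A : Fin m → Matrix (Fin n) (Fin n) ℝ)
    (hB : IsRegFRStep n B 0 (partialSum r 1))
    (hA : ∀ k : Fin m, IsRegFRStep n (A k) (partialSum r (k.val + 1)) (partialSum r (k.val + 2)))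
    (hnonzero : ∀ k : Fin m, ∃ a b : Fin n,
      partialSum r k.val ≤ a.val ∧ a.val < partialSum r (k.val + 1) ∧
      partialSum r (k.val + 2) ≤ b.val ∧ A k a b ≠ 0) :
    ∀ x : Fin m → ℝ, (B - ∑ i, x i • A i).PosSemidef → x = 0 := by
  intro x hx
  suffices h : ∀ d : ℕ, ∀ k : Fin m, m - k.val = d → x k = 0 from funext fun k => h _ k rfl
  intro d
  induction d using Nat.strong_induction_on with
  | _ d ih =>
    intro k hk
    have hlater : ∀ j, k < j → x j = 0 := fun j hj =>
      ih (m - j.val) (by have := j.isLt; have : k.val < j.val := hj; omega) j rfl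
    obtain ⟨a, b, ha, -, hb, hne⟩ := hnonzero k
    have mono := partialSum_mono r
    have hB0 : ∀ c, B c b = 0 := fun c =>
      hB.apply_eq_zero (Nat.zero_le _) (Nat.zero_le _) ((mono (by omega)).trans hb)
    have hA0 : ∀ j : Fin m, j ≤ k → ∀ c : Fin n,
        partialSum r (j.val + 1) ≤ c.val → A j c b = 0 := fun j hj c hc => by
      have hjk : j.val ≤ k.val := hj
      exact (hA j).apply_eq_zero hc ((mono (by omega)).trans hb) ((mono (by omega)).trans hb)
    have hdiag : (B - ∑ i, x i • A i) b b = 0 := by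
      rw [Matrix.sub_apply, hB0, Matrix.sum_apply, Finset.sum_eq_zero, sub_zero]
      intro j _
      rcases le_or_gt j k with hj | hj
      · have hjk : j.val ≤ k.val := hj
        simp [hA0 j hj b ((mono (by omega)).trans hb)]
      · simp [hlater j hj]
    have hoff := hx.apply_eq_zero_of_diag_eq_zero_s16 a hdiag
    rw [Matrix.sub_apply, hB0, Matrix.sum_apply,
      Finset.sum_eq_single_of_mem k (Finset.mem_univ k)] at hoff
    · simpa [hne] using hoff
    · intro j _ hjk
      rcases lt_or_gt_of_ne hjk with hj | hj
      · have hjk' : j.val < k.val := hj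
        simp [hA0 j hj.le a ((mono (by omega)).trans ha)]
      · simp [hlater j hj]
end
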